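/- Let q be a prime power, k ≥ 2 and t ≥ 1 integers. If there exists an [n,k]_q maximum weight spectrum code with n < q^t, then there exists an [N,k+1]_q maximum weight spectrum code with N < q^{t+k+1}. -/

import Mathlib

/-- The Hamming weight of a vector: the number of nonzero coordinates. -/
def wt {ι F : Type*} [Fintype ι] [Zero F] [DecidableEq F] (c : ι → F) : ℕ :=
  (Finset.univ.filter fun i => c i ≠ 0).card

/-- The weight set of a code: the set of nonzero weights of nonzero codewords. -/
def wtSet {ι F : Type*} [Fintype ι] [Zero F] [DecidableEq F] (C : Set (ι → F)) : Set ℕ :=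
  {w | ∃ c ∈ C, c ≠ 0 ∧ wt c = w}

theorem wt_smul {ι F : Type*} [Fintype ι] [Field F] [DecidableEq F] {a : F} (ha : a ≠ 0)
    (c : ι → F) : wt (a • c) = wt c := by
  simp [wt, ha]

theorem wt_eq_zero {ι F : Type*} [Fintype ι] [Zero F] [DecidableEq F] {c : ι → F} :
    wt c = 0 ↔ c = 0 := by
  simp [wt, Finset.filter_eq_empty_iff, funext_iff]

theorem wt_comp_equiv {ι κ F : Type*} [Fintype ι] [Fintype κ] [Zero F] [DecidableEq F]
    (e : κ ≃ ι) (c : ι → F) : wt (c ∘ e) = wt c := by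
  simp only [wt, Finset.card_filter, Function.comp_apply]
  exact e.sum_comp fun i => if c i ≠ 0 then 1 else 0

/-- A function on a finite-dimensional space over a finite field that is invariant under nonzero
scalars takes as many values on nonzero vectors as there are points of the projective space
if and only if it separates these points. -/
theorem ncard_values_eq_iff {F V : Type*} [Field F] [Fintype F] [AddCommGroup V] [Module F V]
    [Module.Finite F V] (W : V → ℕ) (hW : ∀ (a : F) (v : V), a ≠ 0 → W (a • v) = W v) :
    {w | ∃ v, v ≠ 0 ∧ W v = w}.ncard =
        (Fintype.card F ^ Module.finrank F V - 1) / (Fintype.card F - 1) ↔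
      ∀ u v, u ≠ 0 → v ≠ 0 → W u = W v → ∃ a : F, a • v = u := by
  have : Finite V := Module.finite_of_finite F
  have hcard : Nat.card (Projectivization F V) =
      (Fintype.card F ^ Module.finrank F V - 1) / (Fintype.card F - 1) := by
    rw [Projectivization.card_of_finrank F V rfl, Nat.card_eq_fintype_card,
      Nat.geomSum_eq Fintype.one_lt_card]
  let f : Projectivization F V → ℕ := Projectivization.lift (fun v => W v) (by
    rintro ⟨u, hu⟩ ⟨v, hv⟩ a h
    simp only at h ⊢
    subst h
    exact hW a v (by rintro rfl; simp at hu))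
  have hf (v : V) (hv : v ≠ 0) : f (.mk F v hv) = W v := rfl
  have hset : {w | ∃ v, v ≠ 0 ∧ W v = w} = f '' Set.univ := by
    ext w
    simp only [Set.mem_ofPred_eq, Set.image_univ, Set.mem_range]
    constructor
    · rintro ⟨v, hv, rfl⟩
      exact ⟨.mk F v hv, rfl⟩
    · rintro ⟨p, rfl⟩
      induction p using Projectivization.ind with
      | h v hv => exact ⟨v, hv, rfl⟩
  rw [hset, ← hcard, ← Set.ncard_univ, Set.ncard_image_iff, Set.injOn_univ]
  constructor
  · intro h u v hu hv huv
    exact (Projectivization.mk_eq_mk_iff' F u v hu hv).1 (h (by simpa only [hf] using huv))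
  · intro h p p'
    induction p using Projectivization.ind with
    | h u hu =>
      induction p' using Projectivization.ind with
      | h v hv =>
        intro huv
        exact (Projectivization.mk_eq_mk_iff' F u v hu hv).2 (h u v hu hv huv)

theorem ncard_wtSet_range_eq_iff {ι F V : Type*} [Fintype ι] [Field F] [Fintype F] [DecidableEq F]
    [AddCommGroup V] [Module F V] [Module.Finite F V] (T : V →ₗ[F] ι → F)
    (hT : Function.Injective T) :
    (wtSet (LinearMap.range T : Set (ι → F))).ncard =
        (Fintype.card F ^ Module.finrank F V - 1) / (Fintype.card F - 1) ↔
      ∀ u v, u ≠ 0 → v ≠ 0 → wt (T u) = wt (T v) → ∃ a : F, a • v = u := by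
  rw [← ncard_values_eq_iff (F := F) (fun v => wt (T v))
    fun a v ha => by rw [map_smul, wt_smul ha]]
  congr! 2
  ext w
  simp [wtSet, map_eq_zero_iff T hT]

theorem exists_equiv_fin_map_zero {α : Type*} [Fintype α] [Zero α] {q : ℕ}
    (h : Fintype.card α = q) : ∃ e : α ≃ Fin q, (e 0 : ℕ) = 0 := by
  let e := Fintype.equivFinOfCardEq h
  let z : Fin q := ⟨0, h ▸ Fintype.card_pos⟩
  exact ⟨e.trans (Equiv.swap (e 0) z), by simp [z]⟩

theorem sum_mul_pow_injective {k q : ℕ} :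
    Function.Injective fun f : Fin k → Fin q => ∑ i, (f i : ℕ) * q ^ (i : ℕ) := by
  intro f g h
  apply finFunctionFinEquiv.injective
  ext
  simpa only [finFunctionFinEquiv_apply] using h

theorem sum_mul_pow_lt {k q : ℕ} (f : Fin k → Fin q) :
    ∑ i, (f i : ℕ) * q ^ (i : ℕ) < q ^ k := by
  rw [← finFunctionFinEquiv_apply]
  exact (finFunctionFinEquiv f).2

theorem sum_sum_mul_pow_add_pow_lt {k q : ℕ} (hq : 2 ≤ q) :
    (∑ i : Fin k, ∑ j : Fin q, (j : ℕ) * q ^ (i : ℕ)) + q ^ k < q ^ (k + 1) := by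
  have h1 : (∑ j : Fin q, (j : ℕ)) * 2 = q * (q - 1) := by
    rw [Fin.sum_univ_eq_sum_range (fun j => j), Finset.sum_range_id_mul_two]
  have h2 : (∑ i : Fin k, q ^ (i : ℕ)) * (q - 1) + 1 = q ^ k := by
    rw [Fin.sum_univ_eq_sum_range (fun j => q ^ j)]
    obtain ⟨r, rfl⟩ : ∃ r, q = r + 1 := ⟨q - 1, by omega⟩
    simpa using geom_sum_mul_add r k
  simp only [← Finset.sum_mul, ← Finset.mul_sum]
  obtain ⟨r, rfl⟩ : ∃ r, q = r + 1 := ⟨q - 1, by omega⟩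
  simp only [Nat.add_sub_cancel] at h1 h2
  rw [pow_succ]
  set A := ∑ j : Fin (r + 1), (j : ℕ)
  set B := ∑ i : Fin k, (r + 1) ^ (i : ℕ)
  rw [← h2]
  have : A * B * 2 = (r + 1) * (B * r) := by
    rw [mul_right_comm, h1]
    ring
  have hX : B * r ≤ B * r * r := Nat.le_mul_of_pos_right _ (by omega)
  nlinarith

/-- The coordinates of `lineSeparatingMap`. -/
abbrev LineSeparatingIndex (k q : ℕ) : Type :=
  (Σ p : Fin k × Fin q, Fin (p.2 * q ^ (p.1 : ℕ))) ⊕ Fin (q ^ k)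

/-- The functional `(u, a) ↦ α * u i + a`, for `α` the element of `F` with label `j`, repeated
`j * q ^ i` times, together with `q ^ k` copies of `(u, a) ↦ a`. -/
def lineSeparatingMap {F : Type*} [Field F] {q : ℕ} (k : ℕ) (e : F ≃ Fin q) :
    (Fin k → F) × F →ₗ[F] LineSeparatingIndex k q → F :=
  LinearMap.pi <| Sum.elim
    (fun x => e.symm x.1.2 • (LinearMap.proj x.1.1 ∘ₗ LinearMap.fst F (Fin k → F) F) +
      LinearMap.snd F (Fin k → F) F)
    fun _ => LinearMap.snd F (Fin k → F) F

theorem card_lineSeparatingIndex_lt {k q : ℕ} (hq : 2 ≤ q) :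
    Fintype.card (LineSeparatingIndex k q) < q ^ (k + 1) := by
  simpa [Fintype.sum_prod_type] using sum_sum_mul_pow_add_pow_lt (k := k) hq

section LineSeparating

variable {F : Type*} [Field F] [DecidableEq F] {k q : ℕ} {e : F ≃ Fin q}

theorem card_filter_lineSeparatingMap_eq_zero (u : Fin k → F) (a : F) :
    (Finset.univ.filter fun x => lineSeparatingMap k e (u, a) x = 0).card =
      (∑ i : Fin k, ∑ j : Fin q, if e.symm j * u i + a = 0 then (j : ℕ) * q ^ (i : ℕ) else 0) +
        if a = 0 then q ^ k else 0 := by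
  rw [Finset.card_filter, Fintype.sum_sum_type, Fintype.sum_sigma, Fintype.sum_prod_type]
  change (∑ i : Fin k, ∑ j : Fin q, ∑ _ : Fin (j * q ^ (i : ℕ)),
    if e.symm j * u i + a = 0 then 1 else 0) + (∑ _ : Fin (q ^ k), if a = 0 then 1 else 0) = _
  simp

theorem card_filter_lineSeparatingMap_eq_zero_of_ne_zero (he : (e 0 : ℕ) = 0) (u : Fin k → F)
    {a : F} (ha : a ≠ 0) :
    (Finset.univ.filter fun x => lineSeparatingMap k e (u, a) x = 0).card =
      ∑ i : Fin k, (e (-a / u i) : ℕ) * q ^ (i : ℕ) := by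
  rw [card_filter_lineSeparatingMap_eq_zero, if_neg ha, add_zero]
  refine Finset.sum_congr rfl fun i _ => ?_
  by_cases hu : u i = 0
  · simp [hu, ha, he]
  · have h (j : Fin q) : e.symm j * u i + a = 0 ↔ j = e (-a / u i) := by
      rw [← Equiv.symm_apply_eq, eq_div_iff hu, eq_neg_iff_add_eq_zero]
    simp [h]

theorem eq_of_wt_lineSeparatingMap_eq (he : (e 0 : ℕ) = 0) {u : Fin k → F} (hu : u ≠ 0) {a b : F}
    (h : wt (lineSeparatingMap k e (u, a)) = wt (lineSeparatingMap k e (u, b))) : a = b := by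
  have hz (a : F) : (Finset.univ.filter fun x => lineSeparatingMap k e (u, a) x = 0).card +
      wt (lineSeparatingMap k e (u, a)) = Fintype.card (LineSeparatingIndex k q) :=
    Finset.card_filter_add_card_filter_not _
  have hab := (hz a).trans (hz b).symm
  rw [h, add_left_inj] at hab
  have h0 : q ^ k ≤
      (Finset.univ.filter fun x => lineSeparatingMap k e (u, 0) x = 0).card := by
    rw [card_filter_lineSeparatingMap_eq_zero, if_pos rfl]
    exact Nat.le_add_left _ _
  have h1 {a : F} (ha : a ≠ 0) :
      (Finset.univ.filter fun x => lineSeparatingMap k e (u, a) x = 0).card < q ^ k := by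
    rw [card_filter_lineSeparatingMap_eq_zero_of_ne_zero he u ha]
    exact sum_mul_pow_lt fun i => e (-a / u i)
  by_cases ha : a = 0 <;> by_cases hb : b = 0
  · rw [ha, hb]
  · subst ha
    exact absurd (h1 hb) (by omega)
  · subst hb
    exact absurd (h1 ha) (by omega)
  · rw [card_filter_lineSeparatingMap_eq_zero_of_ne_zero he u ha,
      card_filter_lineSeparatingMap_eq_zero_of_ne_zero he u hb] at hab
    obtain ⟨i, hi⟩ := Function.ne_iff.1 hu
    have := e.injective (congrFun (sum_mul_pow_injective hab) i)
    simpa [div_left_inj' hi] using this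

end LineSeparating

/-- `M` copies of the codeword `A u` followed by the codeword `B (u, a)`. -/
def repeatAppendMap {F V ι κ : Type*} [Field F] [AddCommGroup V] [Module F V] (M : ℕ)
    (A : V →ₗ[F] ι → F) (B : V × F →ₗ[F] κ → F) : V × F →ₗ[F] (ι × Fin M) ⊕ κ → F :=
  LinearMap.pi <| Sum.elim (fun x => LinearMap.proj x.1 ∘ₗ A ∘ₗ LinearMap.fst F V F)
    fun x => LinearMap.proj x ∘ₗ B

theorem wt_repeatAppendMap {F V ι κ : Type*} [Field F] [DecidableEq F] [AddCommGroup V]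
    [Module F V] [Fintype ι] [Fintype κ] (M : ℕ) (A : V →ₗ[F] ι → F) (B : V × F →ₗ[F] κ → F)
    (p : V × F) : wt (repeatAppendMap M A B p) = wt (B p) + M * wt (A p.1) := by
  simp only [wt, Finset.card_filter, Fintype.sum_sum_type, Fintype.sum_prod_type]
  change (∑ i : ι, ∑ _ : Fin M, if A p.1 i ≠ 0 then 1 else 0) +
    (∑ x : κ, if B p x ≠ 0 then 1 else 0) = _
  simp [Finset.mul_sum, add_comm]

theorem exists_smul_eq_of_wt_repeatAppendMap_eq {F V ι κ : Type*} [Field F] [DecidableEq F]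
    [AddCommGroup V] [Module F V] [Fintype ι] [Fintype κ] {M : ℕ} {A : V →ₗ[F] ι → F}
    {B : V × F →ₗ[F] κ → F} (hA : Function.Injective A)
    (hsep : ∀ u v, u ≠ 0 → v ≠ 0 → wt (A u) = wt (A v) → ∃ a : F, a • v = u)
    (hM : Fintype.card κ < M)
    (hB : ∀ u, u ≠ 0 → ∀ a b, wt (B (u, a)) = wt (B (u, b)) → a = b)
    {p p' : V × F} (hp : p ≠ 0) (hp' : p' ≠ 0)
    (h : wt (repeatAppendMap M A B p) = wt (repeatAppendMap M A B p')) :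
    ∃ a : F, a • p' = p := by
  obtain ⟨u, a⟩ := p
  obtain ⟨v, b⟩ := p'
  have hlt (c : κ → F) : wt c < M := (Finset.card_le_univ _).trans_lt hM
  rw [wt_repeatAppendMap, wt_repeatAppendMap] at h
  have hmod := congrArg (· % M) h
  have hdiv := congrArg (· / M) h
  have hM0 : 0 < M := by omega
  simp only [Nat.add_mul_mod_self_left, Nat.mod_eq_of_lt (hlt _)] at hmod
  simp only [Nat.add_mul_div_left _ _ hM0, Nat.div_eq_of_lt (hlt _), zero_add] at hdiv
  by_cases hu : u = 0
  · have hv : v = 0 := by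
      rw [hu, map_zero, wt_eq_zero.2 rfl, eq_comm, wt_eq_zero] at hdiv
      exact (map_eq_zero_iff A hA).1 hdiv
    subst hu hv
    have hb : b ≠ 0 := by simpa using hp'
    exact ⟨a / b, by simp [hb]⟩
  · have hv : v ≠ 0 := by
      rintro rfl
      rw [map_zero, wt_eq_zero.2 rfl, wt_eq_zero] at hdiv
      exact hu ((map_eq_zero_iff A hA).1 hdiv)
    obtain ⟨c, rfl⟩ := hsep u v hu hv hdiv
    have hc : c ≠ 0 := by
      rintro rfl
      simp at hu
    refine ⟨c, ?_⟩
    rw [← wt_smul hc (B (v, b)), ← map_smul, Prod.smul_mk] at hmod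
    rw [Prod.smul_mk, hB _ hu _ _ hmod]

/-- If there exists an `[n,k]_q` maximum weight spectrum code with `n < q^t` (for `k ≥ 2`,
`t ≥ 1`), then there exists an `[N,k+1]_q` maximum weight spectrum code with
`N < q^(t+k+1)`. -/
theorem MWS_induction_step (q k t n : ℕ) (hq : IsPrimePow q) (hk : 2 ≤ k) (ht : 1 ≤ t)
    (F : Type*) [Field F] [Fintype F] [DecidableEq F] (hcard : Fintype.card F = q)
    (hn : n < q ^ t)
    (C : Submodule F (Fin n → F)) (hdim : Module.finrank F C = k)
    (hMWS : (wtSet (C : Set (Fin n → F))).ncard = (q ^ k - 1) / (q - 1)) :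
    ∃ N : ℕ, N < q ^ (t + k + 1) ∧
      ∃ D : Submodule F (Fin N → F),
        Module.finrank F D = k + 1 ∧
        (wtSet (D : Set (Fin N → F))).ncard = (q ^ (k + 1) - 1) / (q - 1) := by
  obtain ⟨e, he⟩ := exists_equiv_fin_map_zero hcard
  have hq2 : 2 ≤ q := hq.two_le
  have hM := card_lineSeparatingIndex_lt (k := k) hq2
  have hsep := (ncard_wtSet_range_eq_iff C.subtype C.injective_subtype).1
    (by rw [Submodule.range_subtype, hcard, hdim, hMWS])
  let b : C ≃ₗ[F] (Fin k → F) := (Module.finBasisOfFinrankEq F C hdim).equivFun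
  let B := lineSeparatingMap k e ∘ₗ (b.prodCongr (LinearEquiv.refl F F)).toLinearMap
  have hB (u : C) (hu : u ≠ 0) (a a' : F) (h : wt (B (u, a)) = wt (B (u, a'))) : a = a' :=
    eq_of_wt_lineSeparatingMap_eq he (b.map_ne_zero_iff.2 hu) h
  let T := repeatAppendMap (q ^ (k + 1)) C.subtype B
  let ε := Fintype.equivFin ((Fin n × Fin (q ^ (k + 1))) ⊕ LineSeparatingIndex k q)
  let T' := (LinearEquiv.funCongrLeft F F ε.symm).toLinearMap ∘ₗ T
  have hwt (p : C × F) : wt (T' p) = wt (T p) := wt_comp_equiv ε.symm (T p)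
  have hT' : Function.Injective T' := by
    rw [injective_iff_map_eq_zero]
    rintro ⟨u, a⟩ h
    have h0 := (hwt (u, a)).symm.trans (wt_eq_zero.2 h)
    rw [wt_repeatAppendMap, Nat.add_eq_zero_iff, mul_eq_zero] at h0
    have hu : u = 0 := by
      have hq0 : q ≠ 0 := by omega
      simpa only [wt_eq_zero, pow_eq_zero_iff', hq0, false_and, false_or, Submodule.subtype_apply,
        ZeroMemClass.coe_eq_zero] using h0.2
    have ha : B (u, a) (Sum.inr ⟨0, by positivity⟩) = 0 := congrFun (wt_eq_zero.1 h0.1) _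
    exact Prod.ext hu ha
  have hfin : Module.finrank F (C × F) = k + 1 := by
    rw [Module.finrank_prod, hdim, Module.finrank_self]
  refine ⟨_, ?_, LinearMap.range T', ?_, ?_⟩
  · rw [Fintype.card_sum, Fintype.card_prod, Fintype.card_fin, Fintype.card_fin]
    calc n * q ^ (k + 1) + Fintype.card (LineSeparatingIndex k q)
        < n * q ^ (k + 1) + q ^ (k + 1) := by omega
      _ = (n + 1) * q ^ (k + 1) := by ring
      _ ≤ q ^ t * q ^ (k + 1) := Nat.mul_le_mul_right _ hn
      _ = q ^ (t + k + 1) := by ring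
  · rw [LinearMap.finrank_range_of_inj hT', hfin]
  · have hiff := ncard_wtSet_range_eq_iff T' hT'
    rw [hfin, hcard] at hiff
    refine hiff.2 ?_
    intro p p' hp hp' h
    rw [hwt, hwt] at h
    exact exists_smul_eq_of_wt_repeatAppendMap_eq C.injective_subtype hsep hM hB hp hp' h
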